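/- Let n ≥ 1 be an integer, let ξ ∈ ℝ^{n+1} have ℚ-linearly independent coordinates, and let S ⊆ ℤ^{n+1}. Suppose there exist positive real numbers a, b, α, β such that b X^{−β} ≤ 𝓛_ξ(X;S) ≤ a X^{−α} for every sufficiently large real number X. Then α + α²/β + ⋯ + αⁿ/β^{n−1} ≤ 1. -/

import Mathlib

open Filter

/-- Euclidean norm of an integer point of `ℤ^{n+1}`. -/
noncomputable def inorm {n : ℕ} (x : Fin (n + 1) → ℤ) : ℝ :=
  Real.sqrt (∑ k, ((x k : ℝ)) ^ 2)

/-- `L_ξ(x) = max_{1 ≤ k ≤ n} |ξ₀ x_k − ξ_k x₀|` (the term `k = 0` vanishes, so the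
maximum over all `k` agrees with the maximum over `1 ≤ k ≤ n` when `n ≥ 1`). -/
noncomputable def Lxi {n : ℕ} (ξ : Fin (n + 1) → ℝ) (x : Fin (n + 1) → ℤ) : ℝ :=
  Finset.univ.sup' Finset.univ_nonempty fun k => |ξ 0 * (x k : ℝ) - ξ k * (x 0 : ℝ)|

/-- `𝓛_ξ(X; S) = min { L_ξ(x) : x ∈ S, 0 < ‖x‖ ≤ X }`, with the convention `min ∅ = ∞`. -/
noncomputable def calL {n : ℕ} (ξ : Fin (n + 1) → ℝ) (S : Set (Fin (n + 1) → ℤ)) (X : ℝ) :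
    ENNReal :=
  sInf { l | ∃ x ∈ S, x ≠ 0 ∧ inorm x ≤ X ∧ l = ENNReal.ofReal (Lxi ξ x) }


noncomputable def eSeq (α θ : ℝ) : ℕ → ℝ
  | 0 => 1
  | k + 1 => 1 - α + θ * (eSeq α θ k - 1)

lemma eSeq_le_one (α θ : ℝ) (hα : 0 < α) (hθ : 0 < θ) (k : ℕ) : eSeq α θ k ≤ 1 := by
  induction k with
  | zero => simp [eSeq]
  | succ k ih => simp only [eSeq]; nlinarith

lemma sum_eq_eSeq (α β : ℝ) (hβ : 0 < β) (n : ℕ) :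
    ∑ k ∈ Finset.Icc 1 n, α ^ k / β ^ (k - 1) = 1 - eSeq α (α / β) n := by
  have h1 : ∀ n, eSeq α (α / β) n = 1 - α * ∑ k ∈ Finset.range n, (α / β) ^ k := by
    intro n
    induction n with
    | zero => simp [eSeq]
    | succ k ih =>
      rw [geom_sum_succ, eSeq, ih]; ring
  rw [h1, Finset.mul_sum, Finset.range_eq_Ico, Finset.sum_Ico_eq_sum_range]
  have : Finset.Icc 1 n = Finset.Ico 1 (n + 1) := by ext; simp
  rw [this, Finset.sum_Ico_eq_sum_range]
  simp only [Nat.add_sub_cancel, Nat.sub_zero, Nat.add_sub_cancel_left, zero_add, sub_sub_cancel]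
  refine Finset.sum_congr rfl fun k _ => ?_
  rw [div_pow]; field_simp; ring

lemma numeric_core (α θ C c : ℝ) (hα : 0 < α) (hθ : 0 < θ) (hC : 0 < C) (hc : 0 < c) (n : ℕ)
    (he : eSeq α θ n < 0) :
    ∃ M : ℝ, ∀ Y Z : ℕ → ℝ, 1 ≤ Y 0 → (∀ j < n, Y j ≤ Z j ∧ Z j ≤ Y (j + 1) ∧
      c * Y (j + 1) ^ θ ≤ Z j) →
      1 ≤ C * (Y 0 * ∏ j ∈ Finset.range n, (Y (j + 1) ^ (1 - α) / Z j)) → Y 0 ≤ M := by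
  classical
  have hex : ∃ m, eSeq α θ m < 0 := ⟨n, he⟩
  obtain ⟨m, hm, hmin⟩ : ∃ m, eSeq α θ m < 0 ∧ ∀ k < m, 0 ≤ eSeq α θ k :=
    ⟨Nat.find hex, Nat.find_spec hex, fun k hk => not_lt.mp (Nat.find_min hex hk)⟩
  have hmn : m ≤ n := by
    by_contra h
    exact absurd (hmin n (by omega)) (not_le.mpr he)
  have hpos : ∀ Y Z : ℕ → ℝ, 1 ≤ Y 0 → (∀ j < n, Y j ≤ Z j ∧ Z j ≤ Y (j + 1) ∧
      c * Y (j + 1) ^ θ ≤ Z j) → ∀ j ≤ n, Y 0 ≤ Y j := by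
    intro Y Z h0 h j
    induction j with
    | zero => intro _; exact le_rfl
    | succ j ih =>
      intro hj
      have := h j (by omega)
      linarith [ih (by omega)]
  have claim1 : ∀ k ≤ m, ∃ K > 0, ∀ Y Z : ℕ → ℝ, 1 ≤ Y 0 → (∀ j < n, Y j ≤ Z j ∧ Z j ≤ Y (j + 1) ∧
      c * Y (j + 1) ^ θ ≤ Z j) →
      Y 0 * ∏ j ∈ Finset.range k, (Y (j + 1) ^ (1 - α) / Z j) ≤ K * Y k ^ (eSeq α θ k) := by
    intro k
    induction k with
    | zero => intro _; exact ⟨1, one_pos, fun Y Z _ _ => by simp [eSeq]⟩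
    | succ k ih =>
      intro hk
      obtain ⟨K, hK, hKY⟩ := ih (by omega)
      refine ⟨K * c ^ (eSeq α θ k - 1), by positivity, fun Y Z h0 h => ?_⟩
      have hp := hpos Y Z h0 h
      obtain ⟨h1, h2, h3⟩ := h k (by omega)
      have hYk : 1 ≤ Y k := h0.trans (hp k (by omega))
      have hYk1 : 1 ≤ Y (k + 1) := h0.trans (hp (k + 1) (by omega))
      have hZ : 0 < Z k := by linarith
      have hY1 : 0 < Y (k + 1) := by linarith
      rw [Finset.prod_range_succ, ← mul_assoc]
      calc _ ≤ (K * Y k ^ (eSeq α θ k)) * (Y (k + 1) ^ (1 - α) / Z k) := by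
            exact mul_le_mul_of_nonneg_right (hKY Y Z h0 h) (by positivity)
        _ ≤ (K * Z k ^ (eSeq α θ k)) * (Y (k + 1) ^ (1 - α) / Z k) := by
            gcongr
            exact hmin k (by omega)
        _ = K * Z k ^ (eSeq α θ k - 1) * Y (k + 1) ^ (1 - α) := by
            rw [Real.rpow_sub_one hZ.ne']; ring
        _ ≤ K * (c * Y (k + 1) ^ θ) ^ (eSeq α θ k - 1) * Y (k + 1) ^ (1 - α) := by
            gcongr K * ?_ * _
            exact Real.rpow_le_rpow_of_nonpos (by positivity) h3
              (by linarith [eSeq_le_one α θ hα hθ k])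
        _ = _ := by
            rw [Real.mul_rpow hc.le (by positivity), ← Real.rpow_mul hY1.le, eSeq,
              Real.rpow_add hY1 (1 - α)]
            ring
  obtain ⟨K, hK, hKY⟩ := claim1 m le_rfl
  have hneg : 1 - α - θ < 0 := by
    cases m with
    | zero => simp [eSeq] at hm; linarith
    | succ k =>
      have := hmin k (by omega)
      simp only [eSeq] at hm
      nlinarith
  have claim2 : ∀ d, m + d ≤ n → ∀ Y Z : ℕ → ℝ, 1 ≤ Y 0 → (∀ j < n, Y j ≤ Z j ∧ Z j ≤ Y (j + 1) ∧
      c * Y (j + 1) ^ θ ≤ Z j) →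
      Y 0 * ∏ j ∈ Finset.range (m + d), (Y (j + 1) ^ (1 - α) / Z j) ≤
        K * Y 0 ^ (eSeq α θ m) * (c⁻¹) ^ d := by
    intro d
    induction d with
    | zero =>
      intro _ Y Z h0 h
      have hp := hpos Y Z h0 h m hmn
      simp only [add_zero, pow_zero, mul_one]
      refine (hKY Y Z h0 h).trans ?_
      gcongr K * ?_
      exact Real.rpow_le_rpow_of_nonpos (by linarith) hp hm.le
    | succ d ih =>
      intro hd Y Z h0 h
      have hp := hpos Y Z h0 h
      obtain ⟨h1, h2, h3⟩ := h (m + d) (by omega)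
      have hYk : 1 ≤ Y (m + d) := h0.trans (hp _ (by omega))
      have hYk1 : 1 ≤ Y (m + d + 1) := h0.trans (hp _ (by omega))
      have hZ : 0 < Z (m + d) := by linarith
      have hY1 : 0 < Y (m + d + 1) := by linarith
      rw [← add_assoc, Finset.prod_range_succ, ← mul_assoc, pow_succ, ← mul_assoc]
      have hf : Y (m + d + 1) ^ (1 - α) / Z (m + d) ≤ c⁻¹ := by
        rw [div_le_iff₀ hZ]
        calc Y (m + d + 1) ^ (1 - α) ≤ Y (m + d + 1) ^ θ :=
              Real.rpow_le_rpow_of_exponent_le hYk1 (by linarith)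
          _ = c⁻¹ * (c * Y (m + d + 1) ^ θ) := by field_simp
          _ ≤ _ := by gcongr
      have hY0 : 0 < Y 0 := by linarith
      exact mul_le_mul (ih (by omega) Y Z h0 h) hf (by positivity) (by positivity)
  set e := eSeq α θ m
  set B := C * (K * (c⁻¹) ^ (n - m)) with hB
  have hBpos : 0 < B := by positivity
  refine ⟨B ^ (-e)⁻¹, fun Y Z h0 h h1 => ?_⟩
  have h2 := claim2 (n - m) (by omega) Y Z h0 h
  rw [Nat.add_sub_cancel' hmn] at h2
  have hY0 : 0 < Y 0 := by linarith
  have h3 : 1 ≤ B * Y 0 ^ e := by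
    refine h1.trans ?_
    calc _ ≤ C * (K * Y 0 ^ e * (c⁻¹) ^ (n - m)) := by gcongr
      _ = _ := by rw [hB]; ring
  have h4 : Y 0 ^ (-e) ≤ B := by
    rw [Real.rpow_neg hY0.le, inv_le_iff_one_le_mul₀ (by positivity)]
    exact h3
  calc Y 0 = (Y 0 ^ (-e)) ^ (-e)⁻¹ := by
        rw [← Real.rpow_mul hY0.le, mul_inv_cancel₀ (by linarith), Real.rpow_one]
    _ ≤ _ := by
        refine Real.rpow_le_rpow (by positivity) h4 (inv_nonneg.mpr (by linarith))


lemma chain_exists {n : ℕ} (w : ℕ → Fin (n + 1) → ℚ)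
    (hspan : ∀ p, Submodule.span ℚ (w '' Set.Ici p) = ⊤) (p : ℕ) (hw0 : w p ≠ 0) :
    ∃ r : ℕ → ℕ, r 0 = p ∧ (∀ j < n, r j < r (j + 1) ∧
      w (r (j + 1) - 1) ∈ Submodule.span ℚ ((fun i => w (r i)) '' Set.Iic j)) ∧
      LinearIndependent ℚ (fun j : Fin (n + 1) => w (r j)) := by
  classical
  let T : ℕ → ℕ := fun m => sInf {i | p ≤ i ∧ w i ∉ Submodule.span ℚ (w '' Set.Icc p m)}
  let r : ℕ → ℕ := fun j => Nat.rec p (fun _ m => T m) j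
  have hr0 : r 0 = p := rfl
  have hrs : ∀ j, r (j + 1) = T (r j) := fun j => rfl
  -- main induction
  have key : ∀ j ≤ n, p ≤ r j ∧
      Submodule.span ℚ (w '' Set.Icc p (r j)) = Submodule.span ℚ ((fun i => w (r i)) '' Set.Iic j) ∧
      LinearIndependent ℚ (fun i : Fin (j + 1) => w (r i)) →
      (j < n → (p ≤ r (j + 1) ∧ r j < r (j + 1) ∧
        w (r (j + 1)) ∉ Submodule.span ℚ ((fun i => w (r i)) '' Set.Iic j) ∧
        ∀ i, p ≤ i → i < r (j + 1) →
          w i ∈ Submodule.span ℚ ((fun i => w (r i)) '' Set.Iic j))) := by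
    rintro j hj ⟨hp, hU, -⟩ hjn
    have hne : {i | p ≤ i ∧ w i ∉ Submodule.span ℚ (w '' Set.Icc p (r j))}.Nonempty := by
      by_contra hcon
      rw [Set.not_nonempty_iff_eq_empty, Set.eq_empty_iff_forall_notMem] at hcon
      have h1 : Submodule.span ℚ (w '' Set.Ici p) ≤
          Submodule.span ℚ ((fun i => w (r i)) '' Set.Iic j) := by
        rw [Submodule.span_le]
        rintro _ ⟨i, hi, rfl⟩
        have := hcon i
        simp only [Set.mem_ofPred_eq, not_and, not_not] at this
        rw [← hU]
        exact this hi
      rw [hspan, top_le_iff] at h1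
      have h2 := finrank_span_finset_le_card (R := ℚ) ((Finset.Iic j).image (fun i => w (r i)))
      have h3 := Finset.card_image_le (s := Finset.Iic j) (f := fun i => w (r i))
      rw [Finset.coe_image, Finset.coe_Iic, Set.finrank, h1] at h2
      simp at h2 h3
      omega
    have hmem := Nat.sInf_mem hne
    have hlt : ∀ i < r (j + 1), i ∉ {i | p ≤ i ∧ w i ∉ Submodule.span ℚ (w '' Set.Icc p (r j))} :=
      fun i hi => Nat.notMem_of_lt_sInf hi
    change p ≤ r (j + 1) ∧ w (r (j + 1)) ∉ Submodule.span ℚ (w '' Set.Icc p (r j)) at hmem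
    refine ⟨hmem.1, ?_, hU ▸ hmem.2, ?_⟩
    · by_contra hle
      exact hmem.2 (Submodule.subset_span ⟨_, ⟨hmem.1, not_lt.mp hle⟩, rfl⟩)
    · intro i hpi hi
      have := hlt i hi
      simp only [Set.mem_ofPred_eq, not_and, not_not] at this
      rw [← hU]; exact this hpi
  have ind : ∀ j ≤ n, p ≤ r j ∧
      Submodule.span ℚ (w '' Set.Icc p (r j)) = Submodule.span ℚ ((fun i => w (r i)) '' Set.Iic j) ∧
      LinearIndependent ℚ (fun i : Fin (j + 1) => w (r i)) := by
    intro j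
    induction j with
    | zero =>
      intro _
      refine ⟨le_rfl, ?_, ?_⟩
      · rw [hr0]
        have h1 : Set.Iic (0 : ℕ) = {0} := by ext; simp
        simp [h1, hr0]
      · have : Subsingleton (Fin (0 + 1)) := inferInstanceAs (Subsingleton (Fin 1))
        exact LinearIndependent.of_subsingleton (0 : Fin (0 + 1)) (by simpa [hr0] using hw0)
    | succ j ih =>
      intro hj
      have h := ih (by omega)
      obtain ⟨k1, k2, k3, k4⟩ := key j (by omega) h (by omega)
      obtain ⟨h1, h2, h3⟩ := h
      refine ⟨k1, le_antisymm ?_ ?_, ?_⟩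
      · rw [Submodule.span_le]
        rintro _ ⟨i, hi, rfl⟩
        rcases hi.2.lt_or_eq with hlt | heq
        · exact Submodule.span_mono (Set.image_mono (Set.Iic_subset_Iic.mpr (by omega)))
            (k4 i hi.1 hlt)
        · exact Submodule.subset_span ⟨j + 1, by simp, by rw [heq]⟩
      · rw [Submodule.span_le]
        rintro _ ⟨i, hi, rfl⟩
        rcases (show i ≤ j + 1 from hi).lt_or_eq with hlt | heq
        · have h5 : w (r i) ∈ Submodule.span ℚ (w '' Set.Icc p (r j)) := by
            rw [h2]
            exact Submodule.subset_span ⟨i, by simp; omega, rfl⟩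
          exact Submodule.span_mono (Set.image_mono (Set.Icc_subset_Icc_right (by omega))) h5
        · subst heq
          exact Submodule.subset_span ⟨_, ⟨k1, le_rfl⟩, rfl⟩
      · have h6 : (fun i : Fin (j + 1 + 1) => w (r i)) =
            Fin.snoc (α := fun _ => Fin (n + 1) → ℚ) (fun i : Fin (j + 1) => w (r i))
              (w (r (j + 1))) := by
          funext i
          refine Fin.lastCases ?_ (fun i => ?_) i
          · simp
          · simp
        rw [h6, linearIndependent_finSnoc]
        refine ⟨h3, ?_⟩
        have h7 : (Set.range fun i : Fin (j + 1) => w (r i)) =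
            (fun i => w (r i)) '' Set.Iic j := by
          ext v
          constructor
          · rintro ⟨i, rfl⟩
            exact ⟨i, by simp; omega, rfl⟩
          · rintro ⟨i, hi, rfl⟩
            exact ⟨⟨i, by simp at hi; omega⟩, rfl⟩
        rw [h7]
        exact k3
  refine ⟨r, hr0, fun j hj => ?_, (ind n le_rfl).2.2⟩
  obtain ⟨h1, h2, h3⟩ := ind j hj.le
  obtain ⟨k1, k2, k3, k4⟩ := key j hj.le ⟨h1, h2, h3⟩ hj
  exact ⟨k2, k4 _ (by omega) (by omega)⟩

lemma det_bound {m : ℕ} (y : Fin m → Fin m → ℤ)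
    (hy : LinearIndependent ℚ (fun j => (fun k => (y j k : ℚ))))
    (u : Fin m → Fin m → ℚ)
    (hu : ∀ j, u j ∈ Submodule.span ℚ ((fun j => (fun k => (y j k : ℚ))) '' Set.Iio j))
    (D : Fin m → ℝ) (hD : ∀ j k, |(y j k : ℝ) - (u j k : ℝ)| ≤ D j) :
    1 ≤ (m.factorial : ℝ) * ∏ j, D j := by
  classical
  set A : Matrix (Fin m) (Fin m) ℚ := Matrix.of fun j k => (y j k : ℚ) with hA
  have hdetA : A.det = ((Matrix.of y).det : ℤ) := by
    have := (Int.castRingHom ℚ).map_det (Matrix.of y)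
    rw [eq_comm]
    exact this
  have hdet0 : A.det ≠ 0 := by
    have : IsUnit A := Matrix.linearIndependent_rows_iff_isUnit.mp hy
    exact ((Matrix.isUnit_iff_isUnit_det A).mp this).ne_zero
  have hc : ∀ j, ∃ c : Fin m → ℚ, (∀ i, j ≤ i → c i = 0) ∧ u j = ∑ i, c i • A i := by
    intro j
    have h1 := hu j
    rw [← Finset.coe_Iio, Submodule.mem_span_image_finset_iff_exists_fun'] at h1
    obtain ⟨c, hc⟩ := h1
    refine ⟨fun i => if i < j then c i else 0, fun i hi => by simp [not_lt.mpr hi], ?_⟩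
    rw [← hc]
    simp only [ite_smul, zero_smul]
    rw [← Finset.sum_filter]
    refine Finset.sum_congr (by ext; simp) fun i _ => rfl
  choose c hc0 hcu using hc
  set T : Matrix (Fin m) (Fin m) ℚ := Matrix.of fun j i => (if i = j then 1 else 0) - c j i with hT
  have hTdet : T.det = 1 := by
    rw [Matrix.det_of_isLowerTriangular]
    · simp [hT, hc0]
    · intro i j hij
      have : i < j := by simpa using hij
      simp [hT, hc0 i j this.le, this.ne']
  set B : Matrix (Fin m) (Fin m) ℚ := Matrix.of fun j k => (y j k : ℚ) - u j k with hB
  have hTA : T * A = B := by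
    ext j k
    rw [Matrix.mul_apply]
    simp [hT, hB, hcu, sub_mul, Finset.sum_sub_distrib, hA]
  have hBdet : B.det = A.det := by rw [← hTA, Matrix.det_mul, hTdet, one_mul]
  have h1 : (1 : ℝ) ≤ |((B.det : ℚ) : ℝ)| := by
    rw [hBdet, hdetA]
    rw [hdetA] at hdet0
    have : (Matrix.of y).det ≠ 0 := by exact_mod_cast hdet0
    have h2 := Int.one_le_abs this
    push_cast
    exact_mod_cast h2
  refine h1.trans ?_
  rw [Matrix.det_apply']
  push_cast
  refine (Finset.abs_sum_le_sum_abs _ _).trans ?_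
  have h3 : ∀ σ ∈ (Finset.univ : Finset (Equiv.Perm (Fin m))),
      |(((Equiv.Perm.sign σ : ℤ) : ℝ)) * ∏ i, ((B (σ i) i : ℚ) : ℝ)| ≤ ∏ j, D j := by
    intro σ _
    rw [abs_mul, Finset.abs_prod]
    have : |(((Equiv.Perm.sign σ : ℤ) : ℝ))| = 1 := by
      rcases Int.units_eq_one_or (Equiv.Perm.sign σ) with h | h <;> simp [h]
    rw [this, one_mul, ← Equiv.prod_comp σ D]
    refine Finset.prod_le_prod (fun _ _ => abs_nonneg _) fun i _ => ?_
    simpa [hB] using hD (σ i) i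
  refine (Finset.sum_le_card_nsmul _ _ _ h3).trans ?_
  simp [Fintype.card_perm]

lemma abs_le_inorm {n : ℕ} (x : Fin (n + 1) → ℤ) (k : Fin (n + 1)) : |(x k : ℝ)| ≤ inorm x := by
  refine Real.abs_le_sqrt ?_
  exact Finset.single_le_sum (f := fun k => (x k : ℝ) ^ 2) (fun i _ => sq_nonneg _)
    (Finset.mem_univ k)

lemma inorm_le_sum {n : ℕ} (x : Fin (n + 1) → ℤ) : inorm x ≤ ∑ k, |(x k : ℝ)| := by
  refine Real.sqrt_le_iff.mpr ⟨Finset.sum_nonneg fun _ _ => abs_nonneg _, ?_⟩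
  simp_rw [← sq_abs ((x _ : ℤ) : ℝ)]
  exact Finset.sum_sq_le_sq_sum_of_nonneg fun _ _ => abs_nonneg _

lemma le_Lxi {n : ℕ} (ξ : Fin (n + 1) → ℝ) (x : Fin (n + 1) → ℤ) (k : Fin (n + 1)) :
    |ξ 0 * (x k : ℝ) - ξ k * (x 0 : ℝ)| ≤ Lxi ξ x :=
  Finset.le_sup' (fun k => |ξ 0 * (x k : ℝ) - ξ k * (x 0 : ℝ)|) (Finset.mem_univ k)

lemma Lxi_nonneg {n : ℕ} (ξ : Fin (n + 1) → ℝ) (x : Fin (n + 1) → ℤ) : 0 ≤ Lxi ξ x :=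
  (abs_nonneg _).trans (le_Lxi ξ x 0)

lemma finite_adm {n : ℕ} (S : Set (Fin (n + 1) → ℤ)) (X : ℝ) :
    {x | x ∈ S ∧ x ≠ 0 ∧ inorm x ≤ X}.Finite := by
  refine (Set.finite_Icc (fun _ => -⌈X⌉) (fun _ => ⌈X⌉)).subset ?_
  rintro x ⟨-, -, hx⟩
  have h : ∀ k, |x k| ≤ ⌈X⌉ := fun k => by
    have := ((abs_le_inorm x k).trans hx).trans (Int.le_ceil X)
    exact_mod_cast this
  exact ⟨fun k => (abs_le.mp (h k)).1, fun k => (abs_le.mp (h k)).2⟩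

lemma min_exists {n : ℕ} (ξ : Fin (n + 1) → ℝ) (S : Set (Fin (n + 1) → ℤ)) (X q : ℝ) (hq : 0 ≤ q)
    (h : calL ξ S X ≤ ENNReal.ofReal q) :
    ∃ x ∈ S, x ≠ 0 ∧ inorm x ≤ X ∧ Lxi ξ x ≤ q ∧ ∀ y ∈ S, y ≠ 0 → inorm y ≤ X →
      Lxi ξ x ≤ Lxi ξ y ∧ (Lxi ξ y = Lxi ξ x → inorm x ≤ inorm y) := by
  have hne : {x | x ∈ S ∧ x ≠ 0 ∧ inorm x ≤ X}.Nonempty := by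
    by_contra hcon
    rw [Set.not_nonempty_iff_eq_empty, Set.eq_empty_iff_forall_notMem] at hcon
    have : calL ξ S X = ⊤ := by
      rw [calL, sInf_eq_top]
      rintro l ⟨x, h1, h2, h3, -⟩
      exact absurd ⟨h1, h2, h3⟩ (hcon x)
    rw [this] at h
    simp at h
  obtain ⟨x, ⟨h1, h2, h3⟩, hmin⟩ := Set.exists_min_image _
    (fun x => toLex (Lxi ξ x, inorm x)) (finite_adm S X) hne
  have hm : ∀ y ∈ S, y ≠ 0 → inorm y ≤ X →
      Lxi ξ x ≤ Lxi ξ y ∧ (Lxi ξ y = Lxi ξ x → inorm x ≤ inorm y) := by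
    intro y k1 k2 k3
    have := hmin y ⟨k1, k2, k3⟩
    rw [Prod.Lex.toLex_le_toLex] at this
    rcases this with h | ⟨h, h'⟩
    · exact ⟨h.le, fun h'' => absurd h (by simp [h''])⟩
    · exact ⟨h.le, fun _ => h'⟩
  refine ⟨x, h1, h2, h3, ?_, hm⟩
  rw [← ENNReal.ofReal_le_ofReal_iff hq]
  refine le_trans ?_ h
  rw [calL]
  refine le_sInf ?_
  rintro l ⟨y, k1, k2, k3, rfl⟩
  exact ENNReal.ofReal_le_ofReal (hm y k1 k2 k3).1

lemma seq_exists {n : ℕ} (ξ : Fin (n + 1) → ℝ) (S : Set (Fin (n + 1) → ℤ))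
    (a b α β : ℝ) (ha : 0 < a) (hb : 0 < b) (hα : 0 < α) (hβ : 0 < β)
    (hbound : ∀ᶠ X : ℝ in atTop,
      ENNReal.ofReal (b * X ^ (-β)) ≤ calL ξ S X ∧
      calL ξ S X ≤ ENNReal.ofReal (a * X ^ (-α))) :
    ∃ (w : ℕ → Fin (n + 1) → ℤ) (A c : ℝ), 0 < A ∧ 0 < c ∧ (∀ i, w i ≠ 0) ∧
      (∀ i j, i ≤ j → inorm (w i) ≤ inorm (w j)) ∧
      (∀ i j, i ≤ j → Lxi ξ (w j) ≤ Lxi ξ (w i)) ∧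
      Tendsto (fun i => inorm (w i)) atTop atTop ∧
      Tendsto (fun i => Lxi ξ (w i)) atTop (nhds 0) ∧
      (∀ᶠ i in atTop, Lxi ξ (w i) ≤ A * inorm (w (i + 1)) ^ (-α)) ∧
      (∀ᶠ i in atTop, c * inorm (w (i + 1)) ^ (α / β) ≤ inorm (w i)) := by
  obtain ⟨X0, hX0⟩ := eventually_atTop.mp hbound
  set X1 : ℝ := max X0 1 with hX1
  set N0 : ℕ := ⌈X1⌉₊ with hN0
  have hN0X : X1 ≤ N0 := Nat.le_ceil _
  have hX11 : 1 ≤ X1 := le_max_right _ _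
  have hN : ∀ i : ℕ, X1 ≤ ((N0 + i : ℕ) : ℝ) := fun i => by
    push_cast
    linarith [(Nat.cast_nonneg i : (0 : ℝ) ≤ i)]
  have hx : ∀ i : ℕ, _ := fun i => min_exists ξ S ((N0 + i : ℕ) : ℝ)
    (a * ((N0 + i : ℕ) : ℝ) ^ (-α)) (by positivity)
    (hX0 _ ((le_max_left _ _).trans (hN i))).2
  choose w hwS hw0 hwN hwL hwmin using hx
  have hNN : ∀ i j : ℕ, i ≤ j → ((N0 + i : ℕ) : ℝ) ≤ ((N0 + j : ℕ) : ℝ) := fun i j h => by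
    exact_mod_cast Nat.add_le_add_left h N0
  have hanti : ∀ i j, i ≤ j → Lxi ξ (w j) ≤ Lxi ξ (w i) := fun i j h =>
    (hwmin j (w i) (hwS i) (hw0 i) ((hwN i).trans (hNN i j h))).1
  have hmono : ∀ i j, i ≤ j → inorm (w i) ≤ inorm (w j) := by
    intro i j h
    by_cases hle : inorm (w j) ≤ ((N0 + i : ℕ) : ℝ)
    · have h1 := hwmin i (w j) (hwS j) (hw0 j) hle
      exact h1.2 (le_antisymm (hanti i j h) h1.1)
    · exact (hwN i).trans (not_le.mp hle).le
  have hNt : Tendsto (fun i : ℕ => ((N0 + i : ℕ) : ℝ)) atTop atTop := by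
    refine tendsto_natCast_atTop_atTop.comp ?_
    exact tendsto_atTop_mono (fun i => Nat.le_add_left i N0) tendsto_id
  have hLt : Tendsto (fun i => Lxi ξ (w i)) atTop (nhds 0) := by
    refine squeeze_zero (fun i => Lxi_nonneg _ _) hwL ?_
    have := ((tendsto_rpow_neg_atTop hα).comp hNt).const_mul a
    simpa using this
  set c' : ℝ := (b / a) ^ (1 / β) with hc'
  have hc'pos : 0 < c' := by positivity
  have hlow : ∀ i, c' * ((N0 + i : ℕ) : ℝ) ^ (α / β) ≤ max (inorm (w i)) X1 := by
    intro i
    set M := max (inorm (w i)) X1 with hM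
    have hM1 : 1 ≤ M := hX11.trans (le_max_right _ _)
    have hMpos : 0 < M := by linarith
    have hNpos : (0 : ℝ) < ((N0 + i : ℕ) : ℝ) := by linarith [hN i]
    have h1 := (hX0 M ((le_max_left _ _).trans (le_max_right _ _))).1
    have h2 : calL ξ S M ≤ ENNReal.ofReal (Lxi ξ (w i)) :=
      sInf_le ⟨w i, hwS i, hw0 i, le_max_left _ _, rfl⟩
    have h3 := (ENNReal.ofReal_le_ofReal_iff (Lxi_nonneg _ _)).mp (h1.trans h2)
    have h4 := h3.trans (hwL i)
    rw [Real.rpow_neg hMpos.le, Real.rpow_neg hNpos.le, ← div_eq_mul_inv, ← div_eq_mul_inv,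
      div_le_div_iff₀ (by positivity) (by positivity)] at h4
    have h5 : b / a * ((N0 + i : ℕ) : ℝ) ^ α ≤ M ^ β := by
      rw [div_mul_eq_mul_div, div_le_iff₀ ha]; linarith
    have h6 := Real.rpow_le_rpow (by positivity) h5 (by positivity : 0 ≤ 1 / β)
    rw [Real.mul_rpow (by positivity) (by positivity), ← Real.rpow_mul hNpos.le,
      ← Real.rpow_mul hMpos.le, mul_one_div_cancel hβ.ne', Real.rpow_one, mul_one_div] at h6
    exact h6
  have hMt : Tendsto (fun i => max (inorm (w i)) X1) atTop atTop := by
    refine tendsto_atTop_mono hlow ?_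
    exact ((tendsto_rpow_atTop (by positivity : 0 < α / β)).comp hNt).const_mul_atTop hc'pos
  have hEq : ∀ᶠ i in atTop, max (inorm (w i)) X1 = inorm (w i) := by
    filter_upwards [hMt.eventually_gt_atTop X1] with i hi
    rcases lt_max_iff.mp hi with h | h
    · exact max_eq_left h.le
    · exact absurd h (lt_irrefl _)
  have hmt : Tendsto (fun i => inorm (w i)) atTop atTop := hMt.congr' hEq
  have h2N : ∀ i, inorm (w (i + 1)) ≤ 2 * ((N0 + i : ℕ) : ℝ) := by
    intro i
    have h1 := hwN (i + 1)
    have h2 := hN i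
    push_cast at h1 h2 ⊢
    linarith
  refine ⟨w, a * 2 ^ α, c' * 2 ^ (-(α / β)), by positivity, by positivity, hw0, hmono, hanti,
    hmt, hLt, ?_, ?_⟩
  · filter_upwards [(tendsto_add_atTop_iff_nat 1).mpr hmt |>.eventually_gt_atTop 0] with i hi
    refine (hwL i).trans ?_
    have hNpos : (0 : ℝ) < ((N0 + i : ℕ) : ℝ) := by linarith [hN i]
    have h1 := Real.rpow_le_rpow_of_nonpos hi (h2N i) (by linarith : -α ≤ 0)
    rw [Real.mul_rpow (by norm_num) hNpos.le] at h1
    have h2 : (2 : ℝ) ^ α * 2 ^ (-α) = 1 := by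
      rw [← Real.rpow_add (by norm_num)]; simp
    calc a * ((N0 + i : ℕ) : ℝ) ^ (-α) = a * 2 ^ α * (2 ^ (-α) * ((N0 + i : ℕ) : ℝ) ^ (-α)) := by
          rw [show a * 2 ^ α * (2 ^ (-α) * ((N0 + i : ℕ) : ℝ) ^ (-α)) =
            a * ((2 : ℝ) ^ α * 2 ^ (-α)) * ((N0 + i : ℕ) : ℝ) ^ (-α) by ring, h2, mul_one]
      _ ≤ _ := by gcongr
  · filter_upwards [(tendsto_add_atTop_iff_nat 1).mpr hmt |>.eventually_gt_atTop 0, hEq] with i hi he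
    have hNpos : (0 : ℝ) < ((N0 + i : ℕ) : ℝ) := by linarith [hN i]
    have h1 := hlow i
    rw [he] at h1
    refine le_trans ?_ h1
    have h3 := Real.rpow_le_rpow hi.le (h2N i) (by positivity : 0 ≤ α / β)
    rw [Real.mul_rpow (by norm_num) hNpos.le] at h3
    have h2 : (2 : ℝ) ^ (-(α / β)) * 2 ^ (α / β) = 1 := by
      rw [← Real.rpow_add (by norm_num)]; simp
    calc _ ≤ c' * 2 ^ (-(α / β)) * (2 ^ (α / β) * ((N0 + i : ℕ) : ℝ) ^ (α / β)) := by gcongr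
      _ = c' * ((2 : ℝ) ^ (-(α / β)) * 2 ^ (α / β)) * ((N0 + i : ℕ) : ℝ) ^ (α / β) := by ring
      _ = _ := by rw [h2, mul_one]

lemma x0_lower {n : ℕ} (ξ : Fin (n + 1) → ℝ) (hξ0 : ξ 0 ≠ 0) (w : ℕ → Fin (n + 1) → ℤ)
    (hmt : Tendsto (fun i => inorm (w i)) atTop atTop)
    (hLt : Tendsto (fun i => Lxi ξ (w i)) atTop (nhds 0)) :
    ∃ c0 > 0, ∀ᶠ i in atTop, c0 * inorm (w i) ≤ |(w i 0 : ℝ)| := by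
  have hx : 0 < |ξ 0| := abs_pos.mpr hξ0
  set Ξ := ∑ k, |ξ k| with hΞ
  have hΞ0 : |ξ 0| ≤ Ξ := Finset.single_le_sum (f := fun k => |ξ k|) (fun _ _ => abs_nonneg _)
    (Finset.mem_univ 0)
  have hΞpos : 0 < Ξ := by linarith
  refine ⟨|ξ 0| / (2 * Ξ), by positivity, ?_⟩
  filter_upwards [hmt.eventually_ge_atTop (2 * (n + 1) / |ξ 0|),
    hLt.eventually_le_const (zero_lt_one)] with i h1 h2
  have h3 : |ξ 0| * inorm (w i) ≤ ∑ k, (Lxi ξ (w i) + |ξ k| * |(w i 0 : ℝ)|) := by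
    refine (mul_le_mul_of_nonneg_left (inorm_le_sum _) hx.le).trans ?_
    rw [Finset.mul_sum]
    refine Finset.sum_le_sum fun k _ => ?_
    have h4 := le_Lxi ξ (w i) k
    have h5 := abs_sub_abs_le_abs_sub (ξ 0 * (w i k : ℝ)) (ξ k * (w i 0 : ℝ))
    rw [abs_mul, abs_mul] at h5
    linarith
  rw [Finset.sum_add_distrib, ← Finset.sum_mul, ← hΞ] at h3
  simp only [Finset.sum_const, Finset.card_univ, Fintype.card_fin, nsmul_eq_mul] at h3
  push_cast at h3
  rw [div_le_iff₀ hx] at h1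
  have h6 : ((n : ℝ) + 1) * Lxi ξ (w i) ≤ (n + 1) * 1 := by gcongr
  rw [div_mul_eq_mul_div, div_le_iff₀ (by positivity)]
  linarith

lemma tail_span {n : ℕ} (ξ : Fin (n + 1) → ℝ) (hξ : LinearIndependent ℚ ξ)
    (w : ℕ → Fin (n + 1) → ℤ)
    (hw : ∀ᶠ i in atTop, 1 ≤ |(w i 0 : ℝ)|)
    (hLt : Tendsto (fun i => Lxi ξ (w i)) atTop (nhds 0)) (p : ℕ) :
    Submodule.span ℚ ((fun i => (fun k => (w i k : ℚ))) '' Set.Ici p) = ⊤ := by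
  by_contra hne
  obtain ⟨f, hf0, hf⟩ := Submodule.exists_le_ker_of_lt_top _ (lt_top_iff_ne_top.mpr hne)
  set c : Fin (n + 1) → ℚ := fun k => f (Pi.single k 1) with hc
  have hfx : ∀ x : Fin (n + 1) → ℚ, f x = ∑ k, x k * c k := by
    intro x
    rw [LinearMap.pi_apply_eq_sum_univ f x]
    simp only [smul_eq_mul, hc]
    refine Finset.sum_congr rfl fun k _ => ?_
    congr 2
    ext j
    simp [Pi.single_apply, eq_comm]
  have hsum : ∀ i, p ≤ i → ∑ k, (w i k : ℝ) * (c k : ℝ) = 0 := by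
    intro i hi
    have h1 : (fun k => (w i k : ℚ)) ∈ LinearMap.ker f :=
      hf (Submodule.subset_span ⟨i, hi, rfl⟩)
    rw [LinearMap.mem_ker, hfx] at h1
    exact_mod_cast h1
  have hz : ∑ k, (c k : ℝ) * ξ k = 0 := by
    have h1 : ∀ᶠ i in atTop, |∑ k, (c k : ℝ) * ξ k| ≤ (∑ k, |(c k : ℝ)|) * Lxi ξ (w i) := by
      filter_upwards [hw, eventually_ge_atTop p] with i hi hip
      have h2 : (∑ k, (c k : ℝ) * ξ k) * (w i 0 : ℝ) =
          - ∑ k, (c k : ℝ) * (ξ 0 * (w i k : ℝ) - ξ k * (w i 0 : ℝ)) := by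
        have h3 : ∑ k, (c k : ℝ) * (ξ 0 * (w i k : ℝ) - ξ k * (w i 0 : ℝ)) =
            ξ 0 * ∑ k, (w i k : ℝ) * (c k : ℝ) - (∑ k, (c k : ℝ) * ξ k) * (w i 0 : ℝ) := by
          rw [Finset.mul_sum, Finset.sum_mul, ← Finset.sum_sub_distrib]
          exact Finset.sum_congr rfl fun k _ => by ring
        rw [h3, hsum i hip]; ring
      calc |∑ k, (c k : ℝ) * ξ k| ≤ |∑ k, (c k : ℝ) * ξ k| * |(w i 0 : ℝ)| :=
            le_mul_of_one_le_right (abs_nonneg _) hi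
        _ = |∑ k, (c k : ℝ) * (ξ 0 * (w i k : ℝ) - ξ k * (w i 0 : ℝ))| := by
            rw [← abs_mul, h2, abs_neg]
        _ ≤ ∑ k, |(c k : ℝ) * (ξ 0 * (w i k : ℝ) - ξ k * (w i 0 : ℝ))| :=
            Finset.abs_sum_le_sum_abs _ _
        _ ≤ _ := by
            rw [Finset.sum_mul]
            refine Finset.sum_le_sum fun k _ => ?_
            rw [abs_mul]
            exact mul_le_mul_of_nonneg_left (le_Lxi ξ (w i) k) (abs_nonneg _)
    have h2 := hLt.const_mul (∑ k, |(c k : ℝ)|)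
    rw [mul_zero] at h2
    exact abs_eq_zero.mp (le_antisymm (ge_of_tendsto h2 h1) (abs_nonneg _))
  have hc0 : ∀ k, c k = 0 := by
    refine Fintype.linearIndependent_iff.mp hξ c ?_
    simpa [Rat.smul_def] using hz
  apply hf0
  refine LinearMap.ext fun x => ?_
  rw [hfx]
  simp [hc0]

/-- First part of Theorem 1.2. -/
theorem transference_exponents (n : ℕ) (hn : 1 ≤ n) (ξ : Fin (n + 1) → ℝ)
    (hξ : LinearIndependent ℚ ξ) (S : Set (Fin (n + 1) → ℤ))
    (a b α β : ℝ) (ha : 0 < a) (hb : 0 < b) (hα : 0 < α) (hβ : 0 < β)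
    (hbound : ∀ᶠ X : ℝ in atTop,
      ENNReal.ofReal (b * X ^ (-β)) ≤ calL ξ S X ∧
      calL ξ S X ≤ ENNReal.ofReal (a * X ^ (-α))) :
    ∑ k ∈ Finset.Icc 1 n, α ^ k / β ^ (k - 1) ≤ 1 := by
  rw [sum_eq_eSeq α β hβ n]
  by_contra hcon
  have he : eSeq α (α / β) n < 0 := by linarith
  obtain ⟨w, A, c, hA, hc, hw0, hmono, hanti, hmt, hLt, hLA, hLc⟩ :=
    seq_exists ξ S a b α β ha hb hα hβ hbound
  have hξ0 : ξ 0 ≠ 0 := hξ.ne_zero 0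
  have hx : 0 < |ξ 0| := abs_pos.mpr hξ0
  obtain ⟨c0, hc0, hx0⟩ := x0_lower ξ hξ0 w hmt hLt
  have hw1 : ∀ᶠ i in atTop, 1 ≤ |(w i 0 : ℝ)| := by
    filter_upwards [hx0, hmt.eventually_gt_atTop 0] with i h1 h2
    have h3 : 0 < |(w i 0 : ℝ)| := lt_of_lt_of_le (by positivity) h1
    have h4 : w i 0 ≠ 0 := by
      intro h; simp [h] at h3
    exact_mod_cast Int.one_le_abs h4
  have hspan := tail_span ξ hξ w hw1 hLt
  set K : ℝ := A * (1 + 1 / c0) / |ξ 0| with hK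
  have hKpos : 0 < K := by positivity
  obtain ⟨M, hM⟩ := numeric_core α (α / β) (((n + 1).factorial : ℝ) * K ^ n) c hα (by positivity)
    (by positivity) hc n he
  obtain ⟨p, hp⟩ := eventually_atTop.mp (hx0.and (hLA.and (hLc.and ((hmt.eventually_ge_atTop 1).and
    (hmt.eventually_gt_atTop M)))))
  have hwq : (fun i => (fun k => (w i k : ℚ))) p ≠ 0 := by
    intro h
    refine hw0 p (funext fun k => ?_)
    have := congrFun h k
    simpa using this
  obtain ⟨r, hr0, hr, hlin⟩ := chain_exists (fun i => (fun k => (w i k : ℚ))) hspan p hwq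
  have hrp : ∀ j ≤ n, p ≤ r j := by
    intro j
    induction j with
    | zero => intro _; exact hr0.ge
    | succ j ih =>
      intro hj
      have := ih (by omega)
      have := (hr j (by omega)).1
      omega
  have hbad := hM (fun j => inorm (w (r j))) (fun j => inorm (w (r (j + 1) - 1)))
    (by simpa [hr0] using (hp p le_rfl).2.2.2.1) ?_ ?_
  · simp only [hr0] at hbad
    linarith [(hp p le_rfl).2.2.2.2]
  · intro j hj
    have h1 := (hr j hj).1
    have h2 := hrp j hj.le
    refine ⟨hmono _ _ (by omega), hmono _ _ (by omega), ?_⟩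
    have h3 := (hp (r (j + 1) - 1) (by omega)).2.2.1
    rwa [Nat.sub_add_cancel (by omega)] at h3
  · set u : Fin (n + 1) → Fin (n + 1) → ℚ := Fin.cons 0 (fun j : Fin n => fun k =>
      ((w (r (j + 1)) 0 : ℚ) / (w (r (j + 1) - 1) 0 : ℚ)) * (w (r (j + 1) - 1) k : ℚ)) with hu
    set D : Fin (n + 1) → ℝ := Fin.cons (inorm (w (r 0))) (fun j : Fin n =>
      K * (inorm (w (r (j + 1))) ^ (1 - α) / inorm (w (r (j + 1) - 1)))) with hDdef
    have hdet := det_bound (fun j : Fin (n + 1) => w (r j)) hlin u ?_ D ?_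
    · rw [Fin.prod_univ_succ] at hdet
      simp only [hDdef, Fin.cons_zero, Fin.cons_succ] at hdet
      rw [Finset.prod_mul_distrib, Fin.prod_univ_eq_prod_range
        (fun j => inorm (w (r (j + 1))) ^ (1 - α) / inorm (w (r (j + 1) - 1))) n] at hdet
      simp only [Finset.prod_const, Finset.card_univ, Fintype.card_fin] at hdet
      refine hdet.trans (le_of_eq ?_)
      ring
    · intro j
      refine Fin.cases ?_ (fun j => ?_) j
      · simp [hu]
      · simp only [hu, Fin.cons_succ]
        have h1 := (hr j j.2).2
        have h2 := Submodule.smul_mem _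
          ((w (r (j + 1)) 0 : ℚ) / (w (r (j + 1) - 1) 0 : ℚ)) h1
        refine Submodule.span_mono ?_ h2
        rintro _ ⟨i, hi, rfl⟩
        have hi' : i ≤ j := hi
        refine ⟨⟨i, by omega⟩, ?_, rfl⟩
        simp only [Set.mem_Iio, Fin.lt_def, Fin.val_succ]
        omega
    · intro j k
      refine Fin.cases ?_ (fun j => ?_) j
      · simp only [hu, hDdef, Fin.cons_zero]
        simpa using abs_le_inorm (w (r 0)) k
      · simp only [hu, hDdef, Fin.cons_succ, Fin.val_succ]
        have hj := j.2
        have h1 := (hr j hj).1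
        have h2 := hrp j hj.le
        obtain ⟨g1, g2, -, g4, -⟩ := hp (r (j + 1) - 1) (by omega)
        rw [Nat.sub_add_cancel (by omega)] at g2
        have hZY := hmono (r (j + 1) - 1) (r (j + 1)) (by omega)
        have hLL := hanti (r (j + 1) - 1) (r (j + 1)) (by omega)
        set y := w (r (j + 1))
        set z := w (r (j + 1) - 1)
        set Y := inorm y
        set Z := inorm z
        have hZ : 0 < Z := by linarith
        have hY : 0 < Y := by linarith
        have hz0 : 0 < |(z 0 : ℝ)| := lt_of_lt_of_le (by positivity) g1
        have hz0' : (z 0 : ℝ) ≠ 0 := abs_pos.mp hz0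
        push_cast
        have hid : ξ 0 * ((y k : ℝ) - (y 0 : ℝ) / (z 0 : ℝ) * (z k : ℝ)) =
            (ξ 0 * (y k : ℝ) - ξ k * (y 0 : ℝ)) -
              (y 0 : ℝ) / (z 0 : ℝ) * (ξ 0 * (z k : ℝ) - ξ k * (z 0 : ℝ)) := by
          field_simp; ring
        have hq : |(y 0 : ℝ) / (z 0 : ℝ)| ≤ Y / (c0 * Z) := by
          rw [abs_div]
          exact div_le_div₀ hY.le (abs_le_inorm y 0) (by positivity) g1
        have h3 : |ξ 0| * |(y k : ℝ) - (y 0 : ℝ) / (z 0 : ℝ) * (z k : ℝ)| ≤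
            Lxi ξ z * (Y / Z * (1 + 1 / c0)) := by
          rw [← abs_mul, hid]
          refine (abs_sub _ _).trans ?_
          rw [abs_mul]
          have h4 : |(y 0 : ℝ) / (z 0 : ℝ)| * |ξ 0 * (z k : ℝ) - ξ k * (z 0 : ℝ)| ≤
              Y / (c0 * Z) * Lxi ξ z := by
            gcongr
            exact le_Lxi ξ z k
          have h5 : Lxi ξ z ≤ Lxi ξ z * (Y / Z) :=
            le_mul_of_one_le_right (Lxi_nonneg _ _) ((one_le_div hZ).mpr hZY)
          have h6 := le_Lxi ξ y k
          have h7 : Lxi ξ z * (Y / Z * (1 + 1 / c0)) =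
              Lxi ξ z * (Y / Z) + Y / (c0 * Z) * Lxi ξ z := by
            field_simp
          linarith
        have h8 : Lxi ξ z * (Y / Z * (1 + 1 / c0)) ≤ A * Y ^ (-α) * (Y / Z * (1 + 1 / c0)) := by
          gcongr
        have h9 : A * Y ^ (-α) * (Y / Z * (1 + 1 / c0)) = |ξ 0| * (K * (Y ^ (1 - α) / Z)) := by
          rw [sub_eq_add_neg, Real.rpow_add hY, Real.rpow_one, hK]
          field_simp
        have h10 := (h3.trans h8).trans_eq h9
        exact le_of_mul_le_mul_left h10 hx
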